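/- arXiv:1808.03052 — 3 statements merged into one kernel-verified Lean document; each statement's English description precedes it below -/
import Mathlib

section
/- Let A be a semisimple unital complex Banach algebra and let a, b be elements of the socle of A. If ρ(a,b) = 0, then tr(a) = tr(b), where tr denotes the Aupetit–Mouton spectral trace on the socle. -/
open Filter Metric

variable {A : Type*}

/-- The operator `C_{a,b} = L_a - R_b`. -/
noncomputable def Cop [NormedRing A] [NormedAlgebra ℂ A] (a b : A) : Module.End ℂ A :=
  LinearMap.mulLeft ℂ a - LinearMap.mulRight ℂ b

/-- `ρ(a,b) = limsup_n ‖C_{a,b}^n 1‖^{1/n}`. -/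
noncomputable def rho [NormedRing A] [NormedAlgebra ℂ A] (a b : A) : ℝ :=
  Filter.limsup (fun n : ℕ => ‖(Cop a b ^ n) 1‖ ^ (1 / (n : ℝ))) Filter.atTop

/-- The spectral semidistance `d(a,b) = max{ρ(a,b), ρ(b,a)}`. -/
noncomputable def qd [NormedRing A] [NormedAlgebra ℂ A] (a b : A) : ℝ :=
  max (rho a b) (rho b a)

/-- The Riesz projection of `a` at `lam`, computed over a circle of radius `r`. -/
noncomputable def rieszP [NormedRing A] [NormedAlgebra ℂ A] (a : A) (lam : ℂ) (r : ℝ) : A :=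
  ((2 * Real.pi * Complex.I : ℂ))⁻¹ •
    circleIntegral (fun z => Ring.inverse (algebraMap ℂ A z - a)) lam r

open scoped Classical in
/-- The Riesz projection at an isolated spectral point (radius chosen by choice). -/
noncomputable def rieszIdem [NormedRing A] [NormedAlgebra ℂ A] (a : A) (lam : ℂ) : A :=
  if h : ∃ r : ℝ, 0 < r ∧ spectrum ℂ a ∩ closedBall lam r = {lam}
  then rieszP a lam h.choose else 0

/-- The Aupetit–Mouton spectral rank. -/
noncomputable def sRank [NormedRing A] [NormedAlgebra ℂ A] (a : A) : ℕ∞ :=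
  ⨆ x : A, (spectrum ℂ (x * a) \ {0}).encard

/-- Spectral multiplicity at a nonzero isolated spectral point: rank of the Riesz projection. -/
noncomputable def sMult [NormedRing A] [NormedAlgebra ℂ A] (a : A) (lam : ℂ) : ℕ :=
  (sRank (rieszIdem a lam)).toNat

/-- The Aupetit–Mouton spectral trace. -/
noncomputable def sTrace [NormedRing A] [NormedAlgebra ℂ A] (a : A) : ℂ :=
  ∑ᶠ lam ∈ spectrum ℂ a \ {0}, lam * (sMult a lam : ℂ)

/-- `det(1 + λ a)`, the Aupetit–Mouton spectral determinant. -/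
noncomputable def sDet [NormedRing A] [NormedAlgebra ℂ A] (a : A) (lam : ℂ) : ℂ :=
  ∏ᶠ mu ∈ spectrum ℂ a \ {0}, (1 + lam * mu) ^ sMult a mu

/-- The socle: the sum of all minimal left ideals. -/
def socle (A : Type*) [Ring A] : Ideal A := sSup {I : Ideal A | IsAtom I}

/-- Semisimplicity: the Jacobson radical is zero. -/
def IsSemisimpleBA (A : Type*) [Ring A] : Prop := Ideal.jacobson (⊥ : Ideal A) = ⊥

section FiniteSpectrum

/-- Right multiplication by `a` as an endomorphism of the left ideal generated by `a`. -/
def mulRightSpan [Ring A] (a : A) : Module.End A (Ideal.span {a}) :=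
  ((LinearMap.toSpanSingleton A A a).comp (Ideal.span {a}).subtype).codRestrict (Ideal.span {a})
    fun x => Ideal.mul_mem_left _ (x : A) (Ideal.mem_span_singleton_self a)

theorem isSemisimpleModule_socle [Ring A] : IsSemisimpleModule A (socle A) := by
  rw [socle, sSup_eq_iSup]
  refine isSemisimpleModule_biSup_of_isSemisimpleModule_submodule fun I hI => ?_
  have : IsSimpleModule A I := isSimpleModule_iff_isAtom.2 hI
  infer_instance

theorem isSemisimpleModule_span_of_mem_socle [Ring A] {a : A} (ha : a ∈ socle A) :
    IsSemisimpleModule A (Ideal.span {a}) := by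
  have := isSemisimpleModule_socle (A := A)
  have hle : Ideal.span {a} ≤ socle A := by
    rwa [Ideal.span_le, Set.singleton_subset_iff]
  exact IsSemisimpleModule.of_injective (Submodule.inclusion hle) (Submodule.inclusion_injective hle)

/-- The kernel of right multiplication by `a - lam` on the left ideal generated by `a`. -/
def rightEigen [Ring A] [Algebra ℂ A] (a : A) (lam : ℂ) : Submodule A (Ideal.span {a}) :=
  LinearMap.ker ((LinearMap.toSpanSingleton A A (a - algebraMap ℂ A lam)).comp
    (Ideal.span {a}).subtype)

theorem mem_rightEigen [Ring A] [Algebra ℂ A] {a : A} {lam : ℂ} {x : Ideal.span {a}} :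
    x ∈ rightEigen a lam ↔ (x : A) * a = lam • (x : A) := by
  simp [rightEigen, mul_sub, sub_eq_zero, Algebra.smul_def, Algebra.commutes]

theorem iSupIndep_rightEigen [Ring A] [Algebra ℂ A] (a : A) : iSupIndep (rightEigen a) := by
  have key : ∀ lam, (rightEigen a lam).restrictScalars ℂ =
      Module.End.eigenspace ((mulRightSpan a).restrictScalars ℂ) lam := by
    intro lam
    ext x
    rw [Module.End.mem_eigenspace_iff, Submodule.restrictScalars_mem, mem_rightEigen, Subtype.ext_iff]
    rfl
  have hind := Module.End.eigenspaces_iSupIndep ((mulRightSpan a).restrictScalars ℂ)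
  intro lam
  have h := hind lam
  simp only [← key, ← Submodule.restrictScalars_iSup] at h
  rw [Submodule.disjoint_def] at h ⊢
  exact fun x hx hx' => h x hx hx'

theorem mem_resolventSet_of_rightEigen_eq_bot [Ring A] [Algebra ℂ A] {a : A}
    [IsArtinian A (Ideal.span {a})] {lam : ℂ} (hlam : lam ≠ 0) (h : rightEigen a lam = ⊥) :
    lam ∈ resolventSet ℂ a := by
  set c : A := algebraMap ℂ A lam - a with hc
  have hinj : ∀ x : A, x * c = 0 → x = 0 := by
    intro x hx
    have hxa : x * a = lam • x := by
      rw [hc, mul_sub, sub_eq_zero, ← Algebra.commutes, ← Algebra.smul_def] at hx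
      exact hx.symm
    have hmem : x ∈ Ideal.span {a} := by
      have : x = (lam⁻¹ • x) * a := by rw [smul_mul_assoc, hxa, inv_smul_smul₀ hlam]
      rw [this]
      exact Ideal.mul_mem_left _ _ (Ideal.mem_span_singleton_self a)
    have : (⟨x, hmem⟩ : Ideal.span {a}) ∈ rightEigen a lam := mem_rightEigen.2 hxa
    rw [h, Submodule.mem_bot, Subtype.ext_iff] at this
    exact this
  have hmemc : ∀ x ∈ Ideal.span {a}, x * c ∈ Ideal.span {a} := by
    intro x hx
    rw [hc, mul_sub, ← Algebra.commutes]
    exact sub_mem (Ideal.mul_mem_left _ _ hx)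
      (Ideal.mul_mem_left _ _ (Ideal.mem_span_singleton_self a))
  let g : Module.End A (Ideal.span {a}) :=
    ((LinearMap.toSpanSingleton A A c).comp (Ideal.span {a}).subtype).codRestrict (Ideal.span {a})
      fun x => hmemc x x.2
  have hg : Function.Injective g := by
    rw [injective_iff_map_eq_zero]
    intro x hx
    exact Subtype.ext (hinj x (congrArg Subtype.val hx))
  obtain ⟨y, hy⟩ := IsArtinian.surjective_of_injective_endomorphism g hg
    ⟨a, Ideal.mem_span_singleton_self a⟩
  have hya : (y : A) * c = a := congrArg Subtype.val hy
  have hleft : (lam⁻¹ • (1 + (y : A))) * c = 1 := by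
    rw [smul_mul_assoc, add_mul, one_mul, hya, hc, sub_add_cancel, Algebra.algebraMap_eq_smul_one,
      inv_smul_smul₀ hlam]
  have hright : c * (lam⁻¹ • (1 + (y : A))) = 1 := by
    rw [← sub_eq_zero]
    apply hinj
    rw [sub_mul, mul_assoc, hleft, mul_one, one_mul, sub_self]
  exact ⟨⟨c, _, hright, hleft⟩, rfl⟩

theorem finite_spectrum_of_mem_socle [Ring A] [Algebra ℂ A] {a : A} (ha : a ∈ socle A) :
    (spectrum ℂ a).Finite := by
  have := isSemisimpleModule_span_of_mem_socle ha
  have : Module.Finite A (Ideal.span {a}) := Module.Finite.span_singleton A a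
  have hart : IsArtinian A (Ideal.span {a}) :=
    (IsSemisimpleModule.finite_tfae (R := A) (M := Ideal.span {a})).out 0 2 |>.1 this
  have hfin : {lam | rightEigen a lam ≠ ⊥}.Finite :=
    WellFoundedGT.finite_ne_bot_of_iSupIndep (iSupIndep_rightEigen a)
  refine (hfin.insert 0).subset fun lam hlam => ?_
  by_cases h0 : lam = 0
  · exact Or.inl h0
  · exact Or.inr fun h => hlam (mem_resolventSet_of_rightEigen_eq_bot h0 h)

end FiniteSpectrum

section Commutator

variable [NormedRing A] [NormedAlgebra ℂ A]

/-- The iterated commutator `C_{a,b}^n 1`. -/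
noncomputable def iterComm (a b : A) (n : ℕ) : A := (Cop a b ^ n) 1

theorem iterComm_zero (a b : A) : iterComm a b 0 = 1 := by simp [iterComm]

theorem iterComm_succ (a b : A) (n : ℕ) :
    iterComm a b (n + 1) = a * iterComm a b n - iterComm a b n * b := by
  simp [iterComm, pow_succ', Cop]

theorem sub_mul_iterComm (a b : A) (z : ℂ) (n : ℕ) :
    (algebraMap ℂ A z - a) * iterComm a b n =
      iterComm a b n * (algebraMap ℂ A z - b) - iterComm a b (n + 1) := by
  rw [iterComm_succ, sub_mul, mul_sub, Algebra.commutes]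
  abel

theorem norm_iterComm_le (a b : A) (n : ℕ) :
    ‖iterComm a b n‖ ≤ (‖a‖ + ‖b‖) ^ n * ‖(1 : A)‖ := by
  induction n with
  | zero => simp [iterComm_zero]
  | succ n ih =>
    rw [iterComm_succ]
    calc ‖a * iterComm a b n - iterComm a b n * b‖
        ≤ ‖a‖ * ‖iterComm a b n‖ + ‖iterComm a b n‖ * ‖b‖ :=
          (norm_sub_le _ _).trans (add_le_add (norm_mul_le _ _) (norm_mul_le _ _))
      _ = (‖a‖ + ‖b‖) * ‖iterComm a b n‖ := by ring
      _ ≤ (‖a‖ + ‖b‖) * ((‖a‖ + ‖b‖) ^ n * ‖(1 : A)‖) := by gcongr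
      _ = _ := by ring

theorem eventually_norm_iterComm_le {a b : A} (h : rho a b = 0) {ε : ℝ} (hε : 0 < ε) :
    ∀ᶠ n in atTop, ‖iterComm a b n‖ ≤ ε ^ n := by
  have hroot : ∀ n : ℕ, n ≠ 0 → ∀ {x y : ℝ}, 0 ≤ y → x ≤ y ^ n → 0 ≤ x → x ^ (1 / (n : ℝ)) ≤ y := by
    intro n hn x y hy hxy hx
    calc x ^ (1 / (n : ℝ)) ≤ (y ^ n) ^ (1 / (n : ℝ)) := by gcongr
      _ = y := by rw [one_div, Real.pow_rpow_inv_natCast hy hn]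
  have hbdd : IsBoundedUnder (· ≤ ·) atTop
      (fun n : ℕ => ‖(Cop a b ^ n) 1‖ ^ (1 / (n : ℝ))) := by
    refine isBoundedUnder_of_eventually_le (a := (‖a‖ + ‖b‖) * (‖(1 : A)‖ + 1)) ?_
    filter_upwards [eventually_ne_atTop 0] with n hn
    refine hroot n hn (by positivity) ?_ (norm_nonneg _)
    refine (norm_iterComm_le a b n).trans ?_
    rw [mul_pow]
    gcongr
    calc ‖(1 : A)‖ ≤ ‖(1 : A)‖ + 1 := by linarith
      _ ≤ _ := le_self_pow₀ (by linarith [norm_nonneg (1 : A)]) hn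
  have hlt := eventually_lt_of_limsup_lt (show limsup _ atTop < ε from h.trans_lt hε) hbdd
  filter_upwards [hlt, eventually_ne_atTop 0] with n hn hn0
  calc ‖iterComm a b n‖ = (‖iterComm a b n‖ ^ (1 / (n : ℝ))) ^ n := by
        rw [one_div, Real.rpow_inv_natCast_pow (norm_nonneg _) hn0]
    _ ≤ ε ^ n := by
        have : ‖iterComm a b n‖ ^ (1 / (n : ℝ)) < ε := hn
        gcongr

theorem tendsto_norm_iterComm_mul_pow {a b : A} (h : rho a b = 0) {M : ℝ} (hM : 0 ≤ M) :
    Tendsto (fun n => ‖iterComm a b n‖ * M ^ n) atTop (nhds 0) := by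
  have hε : 0 < (2 * (M + 1))⁻¹ := by positivity
  refine squeeze_zero' (Eventually.of_forall fun n => by positivity) ?_
    (tendsto_pow_atTop_nhds_zero_of_lt_one (r := (2 * (M + 1))⁻¹ * M) (by positivity) ?_)
  · filter_upwards [eventually_norm_iterComm_le h hε] with n hn
    rw [mul_pow]
    gcongr
  · rw [inv_mul_lt_one₀ (by positivity)]
    linarith

theorem sub_mul_sum_iterComm {a b : A} {z : ℂ} {R : A} (hR : (algebraMap ℂ A z - b) * R = 1)
    (N : ℕ) : (algebraMap ℂ A z - a) * ∑ n ∈ Finset.range N, iterComm a b n * R ^ (n + 1) =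
      1 - iterComm a b N * R ^ N := by
  induction N with
  | zero => simp [iterComm_zero]
  | succ N ih =>
    rw [Finset.sum_range_succ, mul_add, ih, ← mul_assoc, sub_mul_iterComm, sub_mul, mul_assoc,
      pow_succ' R N, ← mul_assoc (_ - b), hR, one_mul]
    abel

theorem sum_iterComm_mul_sub {a b : A} {z : ℂ} {R : A} (hR : R * (algebraMap ℂ A z - a) = 1)
    (N : ℕ) : (∑ n ∈ Finset.range N, (-1) ^ n * (R ^ (n + 1) * iterComm a b n)) *
      (algebraMap ℂ A z - b) = 1 - (-1) ^ N * (R ^ N * iterComm a b N) := by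
  induction N with
  | zero => simp [iterComm_zero]
  | succ N ih =>
    have hstep : R ^ (N + 1) * iterComm a b N * (algebraMap ℂ A z - b) =
        R ^ N * iterComm a b N + R ^ (N + 1) * iterComm a b (N + 1) := by
      rw [mul_assoc, sub_eq_iff_eq_add.1 (sub_mul_iterComm a b z N).symm, mul_add, ← mul_assoc,
        pow_succ R N, mul_assoc (R ^ N) R, hR, mul_one]
    rw [Finset.sum_range_succ, add_mul, ih, mul_assoc, hstep, pow_succ]
    noncomm_ring

theorem resolvent_eq_sum_add {a b : A} {z : ℂ} (ha : z ∈ resolventSet ℂ a)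
    (hb : z ∈ resolventSet ℂ b) (N : ℕ) :
    resolvent a z = ∑ n ∈ Finset.range N, iterComm a b n * resolvent b z ^ (n + 1) +
      resolvent a z * (iterComm a b N * resolvent b z ^ N) := by
  have h := congrArg (resolvent a z * ·)
    (sub_mul_sum_iterComm (a := a) (Ring.mul_inverse_cancel _ hb) N)
  simp only [← mul_assoc (resolvent a z)] at h
  rw [show resolvent a z * (algebraMap ℂ A z - a) = 1 from Ring.inverse_mul_cancel _ ha, one_mul,
    mul_sub, mul_one] at h
  exact (sub_eq_iff_eq_add.1 h.symm)

theorem sphere_subset_resolventSet {a : A} {lam : ℂ} {r : ℝ} (hr : 0 < r)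
    (h : spectrum ℂ a ∩ closedBall lam r = {lam}) : sphere lam r ⊆ resolventSet ℂ a := by
  intro z hz
  by_contra hza
  have hmem : z ∈ spectrum ℂ a ∩ closedBall lam r := ⟨hza, sphere_subset_closedBall hz⟩
  rw [h, Set.mem_singleton_iff] at hmem
  rw [hmem, mem_sphere, dist_self] at hz
  exact hr.ne hz

theorem exists_near_mem_resolventSet {a : A} (ha : (spectrum ℂ a).Finite) (z : ℂ) {δ : ℝ}
    (hδ : 0 < δ) : ∃ w ∈ resolventSet ℂ a, ‖w - z‖ < δ := by
  have hd : Dense (spectrum ℂ a)ᶜ := ha.countable.dense_compl ℂ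
  obtain ⟨w, hw, hwz⟩ := hd.exists_dist_lt z hδ
  refine ⟨w, by simpa [spectrum] using hw, ?_⟩
  rwa [← dist_eq_norm, dist_comm]

open scoped Classical in
theorem rieszIdem_eq_dite {a : A} {s : Set ℂ} (hs : spectrum ℂ a = s) (lam : ℂ) :
    rieszIdem a lam = if h : ∃ r : ℝ, 0 < r ∧ s ∩ closedBall lam r = {lam}
      then rieszP a lam h.choose else 0 := by
  subst hs
  rfl

variable [CompleteSpace A]

theorem exists_right_inverse_of_rho_eq_zero {a b : A} (h : rho a b = 0) {z : ℂ}
    (hz : z ∈ resolventSet ℂ b) : ∃ g, (algebraMap ℂ A z - a) * g = 1 := by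
  obtain ⟨R, hR, -⟩ := isUnit_iff_exists.1 hz
  obtain ⟨N, hN, hN0⟩ := (((tendsto_norm_iterComm_mul_pow h (norm_nonneg R)).eventually
    (gt_mem_nhds zero_lt_one)).and (eventually_ne_atTop 0)).exists
  have hlt : ‖iterComm a b N * R ^ N‖ < 1 := by
    refine ((norm_mul_le _ _).trans ?_).trans_lt hN
    gcongr
    exact norm_pow_le' _ (Nat.pos_of_ne_zero hN0)
  obtain ⟨v, hv, -⟩ := isUnit_iff_exists.1 (isUnit_one_sub_of_norm_lt_one hlt)
  exact ⟨_, by rw [← mul_assoc, sub_mul_sum_iterComm hR N, hv]⟩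

theorem exists_left_inverse_of_rho_eq_zero {a b : A} (h : rho a b = 0) {z : ℂ}
    (hz : z ∈ resolventSet ℂ a) : ∃ g, g * (algebraMap ℂ A z - b) = 1 := by
  obtain ⟨R, -, hR⟩ := isUnit_iff_exists.1 hz
  obtain ⟨N, hN, hN0⟩ := (((tendsto_norm_iterComm_mul_pow h (norm_nonneg R)).eventually
    (gt_mem_nhds zero_lt_one)).and (eventually_ne_atTop 0)).exists
  have hlt : ‖(-1) ^ N * (R ^ N * iterComm a b N)‖ < 1 := by
    have hsign : ‖(-1) ^ N * (R ^ N * iterComm a b N)‖ = ‖R ^ N * iterComm a b N‖ := by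
      rcases neg_one_pow_eq_or A N with hs | hs <;> simp [hs]
    rw [hsign]
    refine ((norm_mul_le _ _).trans ?_).trans_lt hN
    rw [mul_comm]
    gcongr
    exact norm_pow_le' _ (Nat.pos_of_ne_zero hN0)
  obtain ⟨v, -, hv⟩ := isUnit_iff_exists.1 (isUnit_one_sub_of_norm_lt_one hlt)
  exact ⟨_, by rw [mul_assoc, sum_iterComm_mul_sub hR N, hv]⟩

theorem mem_resolventSet_of_right_inverse {a g : A} (ha : (spectrum ℂ a).Finite) {z : ℂ}
    (hg : (algebraMap ℂ A z - a) * g = 1) : z ∈ resolventSet ℂ a := by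
  obtain ⟨w, hw, hwz⟩ := exists_near_mem_resolventSet ha z (δ := (‖g‖ + 1)⁻¹) (by positivity)
  have hlt : ‖(z - w) • g‖ < 1 := by
    rw [norm_smul, norm_sub_rev]
    calc ‖w - z‖ * ‖g‖ ≤ ‖w - z‖ * (‖g‖ + 1) := by gcongr; linarith
      _ < (‖g‖ + 1)⁻¹ * (‖g‖ + 1) := by gcongr
      _ = 1 := inv_mul_cancel₀ (by positivity)
  have hfac : (algebraMap ℂ A z - a) * (1 - (z - w) • g) = algebraMap ℂ A w - a := by
    rw [mul_sub, mul_one, mul_smul_comm, hg, ← Algebra.algebraMap_eq_smul_one, map_sub]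
    abel
  have hu := isUnit_one_sub_of_norm_lt_one hlt
  exact hu.mul_right_iff.1 (by rwa [hfac])

theorem mem_resolventSet_of_left_inverse {a g : A} (ha : (spectrum ℂ a).Finite) {z : ℂ}
    (hg : g * (algebraMap ℂ A z - a) = 1) : z ∈ resolventSet ℂ a := by
  obtain ⟨w, hw, hwz⟩ := exists_near_mem_resolventSet ha z (δ := (‖g‖ + 1)⁻¹) (by positivity)
  have hlt : ‖(z - w) • g‖ < 1 := by
    rw [norm_smul, norm_sub_rev]
    calc ‖w - z‖ * ‖g‖ ≤ ‖w - z‖ * (‖g‖ + 1) := by gcongr; linarith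
      _ < (‖g‖ + 1)⁻¹ * (‖g‖ + 1) := by gcongr
      _ = 1 := inv_mul_cancel₀ (by positivity)
  have hfac : (1 - (z - w) • g) * (algebraMap ℂ A z - a) = algebraMap ℂ A w - a := by
    rw [sub_mul, one_mul, smul_mul_assoc, hg, ← Algebra.algebraMap_eq_smul_one, map_sub]
    abel
  have hu := isUnit_one_sub_of_norm_lt_one hlt
  exact hu.mul_left_iff.1 (by rwa [hfac])

theorem spectrum_eq_of_rho_eq_zero {a b : A} (ha : (spectrum ℂ a).Finite)
    (hb : (spectrum ℂ b).Finite) (h : rho a b = 0) : spectrum ℂ a = spectrum ℂ b := by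
  refine compl_injective (Set.Subset.antisymm (fun z hz => ?_) fun z hz => ?_)
  · obtain ⟨g, hg⟩ := exists_left_inverse_of_rho_eq_zero h (z := z) (by simpa [spectrum] using hz)
    simpa [spectrum] using mem_resolventSet_of_left_inverse hb hg
  · obtain ⟨g, hg⟩ := exists_right_inverse_of_rho_eq_zero h (z := z) (by simpa [spectrum] using hz)
    simpa [spectrum] using mem_resolventSet_of_right_inverse ha hg

theorem hasDerivAt_resolvent_pow {b : A} {z : ℂ} (hz : z ∈ resolventSet ℂ b) (n : ℕ) :
    HasDerivAt (fun w => resolvent b w ^ n) (-(n : ℂ) • resolvent b z ^ (n + 1)) z := by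
  induction n with
  | zero => simpa using hasDerivAt_const z (1 : A)
  | succ n ih =>
    have hd := ih.fun_mul (spectrum.hasDerivAt_resolvent_const_left hz)
    simp only [← pow_succ] at hd
    refine hd.congr_deriv ?_
    rw [smul_mul_assoc, ← pow_succ, mul_neg, ← pow_add, Nat.cast_succ, neg_add, add_smul, neg_smul,
      neg_smul, one_smul]

theorem continuousOn_resolvent (a : A) : ContinuousOn (resolvent a) (resolventSet ℂ a) :=
  fun _ hz => (spectrum.hasDerivAt_resolvent_const_left hz).continuousAt.continuousWithinAt

theorem circleIntegral_resolvent_eq {a b : A} (h : rho a b = 0) {c : ℂ} {r : ℝ} (hr : 0 ≤ r)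
    (ha : sphere c r ⊆ resolventSet ℂ a) (hb : sphere c r ⊆ resolventSet ℂ b) :
    (∮ z in C(c, r), resolvent a z) = ∮ z in C(c, r), resolvent b z := by
  have hca := (continuousOn_resolvent a).mono ha
  have hcb := (continuousOn_resolvent b).mono hb
  obtain ⟨K, hK⟩ := (isCompact_sphere c r).exists_bound_of_continuousOn hca
  obtain ⟨M, hM⟩ := (isCompact_sphere c r).exists_bound_of_continuousOn hcb
  have hbound : ∀ N : ℕ, ‖(∮ z in C(c, r), resolvent a z) - ∮ z in C(c, r), resolvent b z‖ ≤
      2 * Real.pi * r * (|K| * (‖iterComm a b (N + 1)‖ * |M| ^ (N + 1))) := by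
    intro N
    set E : ℂ → A := fun z => resolvent a z * (iterComm a b (N + 1) * resolvent b z ^ (N + 1))
    set S : ℂ → A := fun z =>
      ∑ n ∈ Finset.range N, iterComm a b (n + 1) * resolvent b z ^ (n + 2)
    have hcE : ContinuousOn E (sphere c r) := by fun_prop
    have hcS : ContinuousOn S (sphere c r) := by fun_prop
    have hS : (∮ z in C(c, r), S z) = 0 := by
      refine circleIntegral.integral_eq_zero_of_hasDerivWithinAt hr
        (f := fun z => ∑ n ∈ Finset.range N,
          iterComm a b (n + 1) * ((-(n + 1 : ℂ)⁻¹) • resolvent b z ^ (n + 1))) fun z hz => ?_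
      refine (HasDerivAt.fun_sum fun n _ => ?_).hasDerivWithinAt
      have hd := ((hasDerivAt_resolvent_pow (hb hz) (n + 1)).const_smul
        (-(n + 1 : ℂ)⁻¹)).const_mul (iterComm a b (n + 1))
      refine hd.congr_deriv ?_
      have hn : (n + 1 : ℂ) ≠ 0 := Nat.cast_add_one_ne_zero n
      rw [smul_smul, Nat.cast_succ, neg_mul_neg, inv_mul_cancel₀ hn, one_smul]
    have hdecomp : (∮ z in C(c, r), resolvent a z) =
        ∮ z in C(c, r), resolvent b z + (S z + E z) := by
      refine circleIntegral.integral_congr hr fun z hz => ?_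
      rw [resolvent_eq_sum_add (ha hz) (hb hz) (N + 1), Finset.sum_range_succ', iterComm_zero]
      simp only [S, E, zero_add, pow_one, one_mul]
      abel
    rw [hdecomp, circleIntegral.integral_add (hcb.circleIntegrable hr)
      (ContinuousOn.circleIntegrable hr (by fun_prop)), circleIntegral.integral_add (hcS.circleIntegrable hr)
      (hcE.circleIntegrable hr), hS, zero_add, add_sub_cancel_left]
    refine circleIntegral.norm_integral_le_of_norm_le_const hr fun z hz => ?_
    refine (norm_mul_le _ _).trans ?_
    gcongr
    · exact (hK z hz).trans (le_abs_self K)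
    · refine (norm_mul_le _ _).trans ?_
      gcongr
      refine (norm_pow_le' _ N.succ_pos).trans ?_
      gcongr
      exact (hM z hz).trans (le_abs_self M)
  have hlim := (((tendsto_norm_iterComm_mul_pow h (abs_nonneg M)).comp
    (tendsto_add_atTop_nat 1)).const_mul |K|).const_mul (2 * Real.pi * r)
  rw [mul_zero, mul_zero] at hlim
  exact sub_eq_zero.1 (norm_le_zero_iff.1 (ge_of_tendsto' hlim hbound))

theorem rieszIdem_eq_of_rho_eq_zero {a b : A} (hs : spectrum ℂ a = spectrum ℂ b)
    (h : rho a b = 0) (lam : ℂ) : rieszIdem a lam = rieszIdem b lam := by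
  rw [rieszIdem_eq_dite hs, rieszIdem_eq_dite rfl]
  split_ifs with hr
  · obtain ⟨hpos, hball⟩ := hr.choose_spec
    exact congrArg _ (circleIntegral_resolvent_eq h hpos.le
      (sphere_subset_resolventSet hpos (by rwa [hs])) (sphere_subset_resolventSet hpos hball))
  · rfl

end Commutator

theorem stmt8 [NormedRing A] [NormedAlgebra ℂ A] [CompleteSpace A]
    (hA : IsSemisimpleBA A) (a b : A) (ha : a ∈ socle A) (hb : b ∈ socle A)
    (h : rho a b = 0) : sTrace a = sTrace b := by
  have hs := spectrum_eq_of_rho_eq_zero (finite_spectrum_of_mem_socle ha)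
    (finite_spectrum_of_mem_socle hb) h
  simp only [sTrace, sMult, hs, rieszIdem_eq_of_rho_eq_zero hs h]
end

section
/- Let A be a semisimple unital complex Banach algebra and a, b ∈ Soc(A) with ρ(a,b) = 0. Then det(1 + λa) = det(1 + λb) for all λ ∈ ℂ, where det denotes the Aupetit–Mouton spectral determinant. -/
open Filter Metric

variable {A : Type*}

/-- An endomorphism of the simple quotient `A ⧸ M` of a Banach algebra is a scalar: it is bounded,
so it has a spectral value, and Schur's lemma applies. -/
theorem exists_eq_algebraMap_of_end_quotient [NormedRing A] [NormedAlgebra ℂ A] [CompleteSpace A]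
    (M : Ideal A) [hM : M.IsMaximal] (T : Module.End A (A ⧸ M)) :
    ∃ c : ℂ, T = algebraMap ℂ (Module.End A (A ⧸ M)) c := by
  have : IsSimpleModule A (A ⧸ M) := isSimpleModule_iff_isCoatom.2 hM.out
  have : Nontrivial (A ⧸ M) := IsSimpleModule.nontrivial A _
  obtain ⟨x, hx⟩ := Submodule.Quotient.mk_surjective M (T (Submodule.Quotient.mk 1))
  have hT (y : A) : T (Submodule.Quotient.mk y) = Submodule.Quotient.mk (y * x) := by
    have h : (Submodule.Quotient.mk y : A ⧸ M) = y • Submodule.Quotient.mk 1 := by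
      rw [← Submodule.Quotient.mk_smul, smul_eq_mul, mul_one]
    rw [h, map_smul, ← hx, ← Submodule.Quotient.mk_smul, smul_eq_mul]
  have hbound (q : A ⧸ M) : ‖T q‖ ≤ ‖x‖ * ‖q‖ := by
    refine le_of_forall_pos_le_add fun ε hε ↦ ?_
    obtain ⟨y, rfl, hy⟩ :=
      Submodule.Quotient.norm_mk_lt q (show 0 < ε / (‖x‖ + 1) by positivity)
    set q : A ⧸ M := Submodule.Quotient.mk y
    calc ‖T q‖ ≤ ‖y * x‖ := by rw [hT]; exact Submodule.Quotient.norm_mk_le _ _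
      _ ≤ ‖y‖ * ‖x‖ := norm_mul_le _ _
      _ ≤ (‖q‖ + ε / (‖x‖ + 1)) * ‖x‖ := by gcongr
      _ = ‖x‖ * ‖q‖ + ε * (‖x‖ / (‖x‖ + 1)) := by ring
      _ ≤ ‖x‖ * ‖q‖ + ε := by
        gcongr
        exact mul_le_of_le_one_right hε.le ((div_le_one (by positivity)).2 (by linarith))
  let T' : (A ⧸ M) →L[ℂ] (A ⧸ M) := (T.restrictScalars ℂ).mkContinuous ‖x‖ hbound
  obtain ⟨c, hc⟩ := spectrum.nonempty (A := (A ⧸ M) →L[ℂ] (A ⧸ M)) T'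
  refine ⟨c, ?_⟩
  by_contra hne
  have hbij := LinearMap.bijective_of_ne_zero (sub_ne_zero.2 (Ne.symm hne))
  exact hc (ContinuousLinearMap.isUnit_iff_bijective.2 hbij)

theorem finite_end_of_isSimpleModule [NormedRing A] [NormedAlgebra ℂ A] [CompleteSpace A]
    (S : Type*) [AddCommGroup S] [Module A S] [Module ℂ S] [IsScalarTower ℂ A S]
    [IsSimpleModule A S] : Module.Finite ℂ (Module.End A S) := by
  obtain ⟨M, hM, ⟨e⟩⟩ := isSimpleModule_iff_quot_maximal.1 ‹IsSimpleModule A S›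
  refine Module.Finite.of_surjective (Algebra.linearMap ℂ (Module.End A S)) fun T ↦ ?_
  obtain ⟨c, hc⟩ := exists_eq_algebraMap_of_end_quotient M
    (e.toLinearMap ∘ₗ T ∘ₗ e.symm.toLinearMap)
  refine ⟨c, LinearMap.ext fun x ↦ e.injective ?_⟩
  have h := LinearMap.congr_fun hc (e x)
  rw [LinearMap.comp_apply, LinearMap.comp_apply, LinearEquiv.coe_coe, LinearEquiv.coe_coe,
    LinearEquiv.symm_apply_apply] at h
  rw [h, Algebra.linearMap_apply, Module.algebraMap_end_apply, Module.algebraMap_end_apply,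
    ← algebraMap_smul A c x, map_smul, algebraMap_smul]

theorem exists_aeval_eq_zero_of_mem_socle [NormedRing A] [NormedAlgebra ℂ A] [CompleteSpace A]
    {a : A} (ha : a ∈ socle A) : ∃ p : Polynomial ℂ, p ≠ 0 ∧ Polynomial.aeval a p = 0 := by
  have hs : IsSemisimpleModule A (socle A) := by
    rw [socle, sSup_eq_iSup]
    refine isSemisimpleModule_biSup_of_isSemisimpleModule_submodule fun I hI ↦ ?_
    have := isSimpleModule_iff_isAtom.2 hI
    infer_instance
  let J : Ideal A := Ideal.span {a}
  have hJ : J ≤ socle A := (Ideal.span_singleton_le_iff_mem _).2 ha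
  have : IsSemisimpleModule A J :=
    .of_injective (Submodule.inclusion hJ) (Submodule.inclusion_injective hJ)
  have : Module.Finite A J := Module.Finite.span_singleton A a
  have haJ : a ∈ J := Ideal.mem_span_singleton_self a
  obtain ⟨n, S, d, hS, -, ⟨e⟩⟩ := IsSemisimpleModule.exists_end_algEquiv_pi_matrix_end ℂ A J
  have hfin (i : Fin n) : Module.Finite ℂ (Module.End A (S i)) := finite_end_of_isSimpleModule _
  have : Module.Finite ℂ (Module.End A J) := Module.Finite.equiv e.symm.toLinearEquiv
  let R : Module.End A J :=
    { toFun x := ⟨x.1 * a, J.mul_mem_left _ haJ⟩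
      map_add' x y := Subtype.ext (add_mul _ _ _)
      map_smul' c x := Subtype.ext (mul_assoc _ _ _) }
  obtain ⟨p, hp, hp0⟩ := IsIntegral.of_finite ℂ R
  have hpow (k : ℕ) (x : J) : ((R ^ k) x : A) = x * a ^ k := by
    induction k with
    | zero => simp
    | succ k ih => rw [pow_succ', Module.End.mul_apply, pow_succ, ← mul_assoc, ← ih]; rfl
  have hq (q : Polynomial ℂ) (x : J) :
      (Polynomial.aeval R q x : A) = x * Polynomial.aeval a q := by
    induction q using Polynomial.induction_on' with
    | add q r hq hr => simp [mul_add, hq, hr]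
    | monomial k c =>
      rw [Polynomial.aeval_monomial, Polynomial.aeval_monomial, Module.End.mul_apply,
        Module.algebraMap_end_apply, ← Algebra.smul_def, mul_smul_comm, ← hpow]
      rfl
  refine ⟨Polynomial.X * p, mul_ne_zero Polynomial.X_ne_zero hp.ne_zero, ?_⟩
  rw [map_mul, Polynomial.aeval_X, ← hq p ⟨a, haJ⟩]
  rw [← Polynomial.aeval_def] at hp0
  simp [hp0]

/-- A spectral resolution of an algebraic element: a partition of unity `e` indexed by the finite
set `S`, commuting with `a`, with `a - μ` nilpotent on the `μ`-th part. -/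
structure SpectralResolution [Ring A] [Algebra ℂ A] (a : A) (S : Finset ℂ) (N : ℕ)
    (e : ℂ → A) : Prop where
  sum_eq_one : ∑ μ ∈ S, e μ = 1
  commute : ∀ μ, Commute a (e μ)
  pow_mul : ∀ μ ∈ S, (a - algebraMap ℂ A μ) ^ N * e μ = 0

open Polynomial in
/-- Elements annihilated by a common polynomial have spectral resolutions over the same set. -/
theorem exists_spectralResolution [Ring A] [Algebra ℂ A] {a b : A} {p : ℂ[X]} (hp : p ≠ 0)
    (ha : aeval a p = 0) (hb : aeval b p = 0) :
    ∃ (S : Finset ℂ) (N : ℕ) (e f : ℂ → A),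
      SpectralResolution a S N e ∧ SpectralResolution b S N f := by
  classical
  let S : Finset ℂ := insert 0 p.roots.toFinset
  let N : ℕ := p.natDegree
  obtain ⟨u, hu⟩ := (exists_sum_eq_one_iff_pairwise_coprime (s := fun μ : ℂ ↦ (X - C μ) ^ N)
    (Finset.insert_nonempty 0 p.roots.toFinset)).2 fun μ ν hne ↦
      (isCoprime_X_sub_C_of_isUnit_sub (sub_ne_zero.2 (Subtype.coe_ne_coe.2 hne)).isUnit).pow
  let g : ℂ → ℂ[X] := fun μ ↦ u μ * ∏ ν ∈ S \ {μ}, (X - C ν) ^ N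
  have hdvd : p ∣ ∏ ν ∈ S, (X - C ν) ^ N := by
    rw [(IsAlgClosed.splits p).eq_prod_roots, Finset.prod_multiset_map_count,
      (isUnit_C.2 (leadingCoeff_ne_zero.2 hp).isUnit).mul_left_dvd]
    refine (Finset.prod_dvd_prod_of_dvd _ _ fun μ _ ↦ pow_dvd_pow _ ?_).trans
      (Finset.prod_dvd_prod_of_subset _ _ _ (Finset.subset_insert _ _))
    exact (Multiset.count_le_card _ _).trans (card_roots' p)
  have key (x : A) (hx : aeval x p = 0) :
      SpectralResolution x S N fun μ ↦ aeval x (g μ) := by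
    refine ⟨by rw [← map_sum, hu, map_one], fun μ ↦ ?_, fun μ hμ ↦ ?_⟩
    · have h := (Commute.all X (g μ)).map (aeval x)
      rwa [aeval_X] at h
    · have h : p ∣ (X - C μ) ^ N * g μ := by
        refine hdvd.trans ⟨u μ, ?_⟩
        rw [← Finset.mul_prod_erase S _ hμ, ← Finset.sdiff_singleton_eq_erase]
        ring
      obtain ⟨q, hq⟩ := h
      have h := congrArg (aeval x) hq
      simpa [hx] using h
  exact ⟨S, N, _, _, key a ha, key b hb⟩

namespace SpectralResolution

section Algebraic

variable [Ring A] [Algebra ℂ A] {a : A} {S : Finset ℂ} {N : ℕ} {e : ℂ → A}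

theorem sub_mul_sum_eq (h : SpectralResolution a S N e) {μ z : ℂ} (hμ : μ ∈ S)
    (hz : e μ ≠ 0 → z ≠ μ) :
    (algebraMap ℂ A z - a) *
      ∑ k ∈ Finset.range N, ((z - μ) ^ (k + 1))⁻¹ • ((a - algebraMap ℂ A μ) ^ k * e μ) = e μ := by
  by_cases he : e μ = 0
  · simp [he]
  have hz' : z - μ ≠ 0 := sub_ne_zero.2 (hz he)
  have hsplit : algebraMap ℂ A z - a = (z - μ) • (1 : A) - (a - algebraMap ℂ A μ) := by
    rw [← Algebra.algebraMap_eq_smul_one, map_sub]; abel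
  have hterm (k : ℕ) : (algebraMap ℂ A z - a) *
      (((z - μ) ^ (k + 1))⁻¹ • ((a - algebraMap ℂ A μ) ^ k * e μ)) =
      ((z - μ) ^ k)⁻¹ • ((a - algebraMap ℂ A μ) ^ k * e μ) -
      ((z - μ) ^ (k + 1))⁻¹ • ((a - algebraMap ℂ A μ) ^ (k + 1) * e μ) := by
    rw [hsplit, sub_mul, smul_mul_assoc, one_mul, smul_smul, mul_smul_comm, ← mul_assoc,
      ← pow_succ']
    congr 2
    field_simp
    rw [pow_succ']
  rw [Finset.mul_sum, Finset.sum_congr rfl fun k _ ↦ hterm k, Finset.sum_range_sub',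
    h.pow_mul μ hμ]
  simp

/-- The partial fraction expansion of the resolvent. -/
theorem inverse_eq (h : SpectralResolution a S N e) {z : ℂ} (hz : ∀ μ ∈ S, e μ ≠ 0 → z ≠ μ) :
    IsUnit (algebraMap ℂ A z - a) ∧ Ring.inverse (algebraMap ℂ A z - a) =
      ∑ μ ∈ S, ∑ k ∈ Finset.range N,
        ((z - μ) ^ (k + 1))⁻¹ • ((a - algebraMap ℂ A μ) ^ k * e μ) := by
  set r : A := ∑ μ ∈ S, ∑ k ∈ Finset.range N,
    ((z - μ) ^ (k + 1))⁻¹ • ((a - algebraMap ℂ A μ) ^ k * e μ)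
  have h1 : (algebraMap ℂ A z - a) * r = 1 := by
    rw [Finset.mul_sum, Finset.sum_congr rfl fun μ hμ ↦ h.sub_mul_sum_eq hμ (hz μ hμ),
      h.sum_eq_one]
  have hcomm : Commute a r := by
    refine Commute.sum_right _ _ _ fun μ _ ↦ Commute.sum_right _ _ _ fun k _ ↦
      Commute.smul_right (Commute.mul_right (Commute.pow_right ?_ _) (h.commute μ)) _
    exact (Commute.refl a).sub_right (Algebra.commutes μ a).symm
  have h2 : r * (algebraMap ℂ A z - a) = 1 := by
    rw [← h1]
    exact (Commute.sub_left (Algebra.commutes z r) hcomm).eq.symm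
  let U : Aˣ := ⟨_, r, h1, h2⟩
  exact ⟨U.isUnit, Ring.inverse_unit U⟩

theorem mem_spectrum_iff (h : SpectralResolution a S N e) {μ : ℂ} :
    μ ∈ spectrum ℂ a ↔ μ ∈ S ∧ e μ ≠ 0 := by
  constructor
  · intro hμ
    by_contra hcon
    refine hμ (h.inverse_eq fun ν hν hne heq ↦ hcon ?_).1
    exact heq ▸ ⟨hν, hne⟩
  · rintro ⟨hμ, hne⟩ hres
    have hu : IsUnit ((a - algebraMap ℂ A μ) ^ N) := by
      rw [← neg_sub]; exact (IsUnit.neg hres).pow N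
    exact hne ((hu.mul_right_eq_zero).1 (h.pow_mul μ hμ))

end Algebraic

/-- The Riesz projection is the corresponding part of the spectral resolution. -/
theorem rieszP_eq [NormedRing A] [NormedAlgebra ℂ A] [CompleteSpace A]
    {a : A} {S : Finset ℂ} {N : ℕ} {e : ℂ → A} (h : SpectralResolution a S N e)
    {lam : ℂ} {r : ℝ} (hr : 0 < r) (hlam : spectrum ℂ a ∩ closedBall lam r = {lam}) :
    rieszP a lam r = e lam := by
  have hlamS : lam ∈ spectrum ℂ a := (hlam.symm ▸ Set.mem_singleton lam :
    lam ∈ spectrum ℂ a ∩ closedBall lam r).1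
  have hball {μ : ℂ} (hμ : μ ∈ S) (he : e μ ≠ 0) (hμr : μ ∈ closedBall lam r) : μ = lam := by
    have : μ ∈ spectrum ℂ a ∩ closedBall lam r := ⟨h.mem_spectrum_iff.2 ⟨hμ, he⟩, hμr⟩
    rwa [hlam] at this
  have hsphere {μ z : ℂ} (hz : z ∈ sphere lam r) (hμ : μ ∈ S) (he : e μ ≠ 0) : z ≠ μ := by
    rintro rfl
    have := hball hμ he (sphere_subset_closedBall hz)
    rw [this, mem_sphere, dist_self] at hz
    exact hr.ne hz
  have hint {μ : ℂ} (hμ : μ ∈ S) (k : ℕ) : CircleIntegrable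
      (fun z ↦ ((z - μ) ^ (k + 1))⁻¹ • ((a - algebraMap ℂ A μ) ^ k * e μ)) lam r := by
    by_cases he : e μ = 0
    · simp [he]
    refine ContinuousOn.circleIntegrable hr.le (ContinuousOn.smul (ContinuousOn.inv₀
      (by fun_prop) fun z hz ↦ pow_ne_zero _ (sub_ne_zero.2 (hsphere hz hμ he)))
      continuousOn_const)
  have hval {μ : ℂ} (hμ : μ ∈ S) (k : ℕ) :
      (∮ z in C(lam, r), ((z - μ) ^ (k + 1))⁻¹ • ((a - algebraMap ℂ A μ) ^ k * e μ)) =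
        if k = 0 ∧ μ = lam then (2 * Real.pi * Complex.I : ℂ) • e μ else 0 := by
    by_cases he : e μ = 0
    · simp [he, circleIntegral]
    rw [circleIntegral.integral_smul_const]
    rcases Nat.eq_zero_or_pos k with rfl | hk
    · by_cases hml : μ = lam
      · subst hml
        simp [circleIntegral.integral_sub_center_inv _ hr.ne']
      · have hd : DiffContOnCl ℂ (fun z : ℂ ↦ ((z - μ) ^ (0 + 1))⁻¹) (ball lam r) := by
          refine DifferentiableOn.diffContOnCl fun z hz ↦ ?_
          have hzμ : (z - μ) ^ (0 + 1) ≠ 0 := by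
            refine pow_ne_zero _ (sub_ne_zero.2 ?_)
            rintro rfl
            exact hml (hball hμ he (closure_ball_subset_closedBall hz))
          have hd : DifferentiableAt ℂ (fun z : ℂ ↦ (z - μ) ^ (0 + 1)) z := by fun_prop
          exact (hd.inv hzμ).differentiableWithinAt
        rw [hd.circleIntegral_eq_zero hr.le]
        simp [hml]
    · have hz : (fun z : ℂ ↦ ((z - μ) ^ (k + 1))⁻¹) = fun z ↦ (z - μ) ^ (-((k : ℤ) + 1)) := by
        ext z
        rw [zpow_neg]
        norm_cast
      rw [hz, circleIntegral.integral_sub_zpow_of_ne (by omega)]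
      simp [hk.ne']
  obtain ⟨hlam', hne⟩ := h.mem_spectrum_iff.1 hlamS
  have hN : 0 < N := by
    rcases Nat.eq_zero_or_pos N with rfl | hN
    · exact absurd (by simpa using h.pow_mul lam hlam') hne
    · exact hN
  rw [rieszP, circleIntegral.integral_congr hr.le fun z hz ↦
    (h.inverse_eq fun μ hμ he ↦ hsphere hz hμ he).2]
  rw [circleIntegral.integral_fun_sum fun μ hμ ↦ CircleIntegrable.fun_sum _ fun k _ ↦ hint hμ k,
    Finset.sum_congr rfl fun μ hμ ↦ circleIntegral.integral_fun_sum fun k _ ↦ hint hμ k,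
    Finset.sum_congr rfl fun μ hμ ↦ Finset.sum_congr rfl fun k _ ↦ hval hμ k,
    Finset.sum_eq_single_of_mem lam hlam' (by intro μ _ hμ; simp [hμ]),
    Finset.sum_eq_single_of_mem 0 (Finset.mem_range.2 hN) (by intro k _ hk; simp [hk])]
  simp only [and_self, if_true, smul_smul]
  rw [inv_mul_cancel₀ Complex.two_pi_I_ne_zero, one_smul]

end SpectralResolution

theorem Cop_pow_mul_mul [NormedRing A] [NormedAlgebra ℂ A] {a b e f : A} (he : Commute a e)
    (hf : Commute b f) (x : A) (n : ℕ) :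
    (Cop a b ^ n) (e * x * f) = e * (Cop a b ^ n) x * f := by
  induction n with
  | zero => simp
  | succ n ih =>
    rw [pow_succ', Module.End.mul_apply, ih, Module.End.mul_apply]
    set y := (Cop a b ^ n) x
    simp only [Cop, LinearMap.sub_apply, LinearMap.mulLeft_apply, LinearMap.mulRight_apply]
    rw [mul_sub, sub_mul, ← mul_assoc, ← mul_assoc, he.eq, ← mul_assoc, mul_assoc _ f b, ← hf.eq,
      ← mul_assoc, ← mul_assoc]

theorem exists_norm_Cop_le [NormedRing A] [NormedAlgebra ℂ A] (a b : A) :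
    ∃ K : ℝ, 0 ≤ K ∧ ∀ x, ‖Cop a b x‖ ≤ K * ‖x‖ := by
  refine ⟨‖a‖ + ‖b‖, by positivity, fun x ↦ ?_⟩
  simp only [Cop, LinearMap.sub_apply, LinearMap.mulLeft_apply, LinearMap.mulRight_apply]
  calc ‖a * x - x * b‖ ≤ ‖a‖ * ‖x‖ + ‖x‖ * ‖b‖ :=
        (norm_sub_le _ _).trans (add_le_add (norm_mul_le _ _) (norm_mul_le _ _))
    _ = _ := by ring

theorem exists_norm_aeval_Cop_le [NormedRing A] [NormedAlgebra ℂ A] (a b : A)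
    (q : Polynomial ℂ) : ∃ K : ℝ, 0 ≤ K ∧ ∀ x, ‖Polynomial.aeval (Cop a b) q x‖ ≤ K * ‖x‖ := by
  induction q using Polynomial.induction_on with
  | C c => exact ⟨‖c‖, norm_nonneg c, fun x ↦ by simp [norm_smul]⟩
  | add p q hp hq =>
    obtain ⟨K, hK, hp⟩ := hp
    obtain ⟨L, hL, hq⟩ := hq
    refine ⟨K + L, by positivity, fun x ↦ ?_⟩
    rw [map_add, LinearMap.add_apply, add_mul]
    exact (norm_add_le _ _).trans (add_le_add (hp x) (hq x))
  | monomial n c hn =>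
    obtain ⟨K, hK, hn⟩ := hn
    obtain ⟨L, hL, hC⟩ := exists_norm_Cop_le a b
    refine ⟨K * L, by positivity, fun x ↦ ?_⟩
    rw [pow_succ, ← mul_assoc, map_mul, Polynomial.aeval_X, Module.End.mul_apply, mul_assoc]
    exact (hn _).trans (by gcongr; exact hC x)

theorem norm_pow_apply_le {E : Type*} [NormedAddCommGroup E] [Module ℂ E]
    {D : Module.End ℂ E} {K : ℝ} (hK : 0 ≤ K) (hD : ∀ x, ‖D x‖ ≤ K * ‖x‖) (n : ℕ) (x : E) :
    ‖(D ^ n) x‖ ≤ K ^ n * ‖x‖ := by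
  induction n with
  | zero => simp
  | succ n ih =>
    rw [pow_succ', Module.End.mul_apply, pow_succ', mul_assoc]
    exact (hD _).trans (by gcongr)

/-- If `ρ(a,b) = 0` then `‖C_{a,b}^n 1‖` decays faster than any geometric sequence. -/
theorem eventually_norm_Cop_pow_lt [NormedRing A] [NormedAlgebra ℂ A] {a b : A}
    (h : rho a b = 0) {ε : ℝ} (hε : 0 < ε) : ∀ᶠ n : ℕ in atTop, ‖(Cop a b ^ n) 1‖ < ε ^ n := by
  obtain ⟨K, hK, hC⟩ := exists_norm_Cop_le a b
  have hbdd : IsBoundedUnder (· ≤ ·) atTop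
      fun n : ℕ ↦ ‖(Cop a b ^ n) 1‖ ^ (1 / (n : ℝ)) := by
    refine isBoundedUnder_of_eventually_le (a := K * (‖(1 : A)‖ + 1)) ?_
    filter_upwards [eventually_ne_atTop 0] with n hn
    rw [one_div, Real.rpow_inv_le_iff_of_pos (norm_nonneg _) (by positivity) (by positivity),
      Real.rpow_natCast, mul_pow]
    refine (norm_pow_apply_le hK hC n 1).trans ?_
    gcongr
    exact (le_add_of_nonneg_right zero_le_one).trans
      (le_self_pow₀ (le_add_of_nonneg_left (norm_nonneg _)) hn)
  have hlt : limsup (fun n : ℕ ↦ ‖(Cop a b ^ n) 1‖ ^ (1 / (n : ℝ))) atTop < ε := by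
    rw [← rho, h]; exact hε
  filter_upwards [eventually_lt_of_limsup_lt hlt hbdd, eventually_gt_atTop 0] with n hn hpos
  rwa [one_div, Real.rpow_inv_lt_iff_of_pos (norm_nonneg _) hε.le (by positivity),
    Real.rpow_natCast] at hn

open Polynomial in
/-- Parts of spectral resolutions of `a` and `b` at distinct points are orthogonal when
`ρ(a,b) = 0`: there `C_{a,b}` is a nonzero scalar plus a nilpotent. -/
theorem SpectralResolution.mul_eq_zero [NormedRing A] [NormedAlgebra ℂ A] {a b : A}
    {S : Finset ℂ} {N : ℕ} {e f : ℂ → A} (he : SpectralResolution a S N e)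
    (hf : SpectralResolution b S N f) (h : rho a b = 0) {μ ν : ℂ} (hμ : μ ∈ S) (hν : ν ∈ S)
    (hne : μ ≠ ν) : e μ * f ν = 0 := by
  set x : A := e μ * f ν
  set T : Module.End ℂ A := Cop a b
  set U := LinearMap.mulLeft ℂ (a - algebraMap ℂ A μ)
  set V := LinearMap.mulRight ℂ (b - algebraMap ℂ A ν)
  have hTU : T - algebraMap ℂ _ (μ - ν) = U - V := by
    ext y
    simp [T, U, V, Cop, sub_mul, mul_sub, sub_smul, Algebra.algebraMap_eq_smul_one]
    abel
  have hUV : Commute U V := LinearMap.commute_mulLeft_right _ _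
  have hUx : (U ^ N) x = 0 := by
    rw [LinearMap.pow_mulLeft, LinearMap.mulLeft_apply, ← mul_assoc, he.pow_mul μ hμ, zero_mul]
  have hVx : (V ^ N) x = 0 := by
    have hc : Commute ((b - algebraMap ℂ A ν) ^ N) (f ν) :=
      ((hf.commute ν).sub_left (Algebra.commutes ν _)).pow_left N
    rw [LinearMap.pow_mulRight, LinearMap.mulRight_apply, mul_assoc, ← hc.eq, hf.pow_mul ν hν,
      mul_zero]
  have hnil : ((T - algebraMap ℂ _ (μ - ν)) ^ (N + N)) x = 0 := by
    let I : Ideal (Module.End ℂ A) := LinearMap.ker (LinearMap.toSpanSingleton _ A x)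
    have hU : U ^ N ∈ I := hUx
    have hV : (-V) ^ N ∈ I := by
      rw [neg_pow]
      exact I.mul_mem_left _ hVx
    rw [hTU, sub_eq_add_neg]
    exact I.add_pow_mem_of_pow_mem_of_le_of_commute hU hV (by omega) hUV.neg_right
  obtain ⟨s, q, hsq⟩ : IsCoprime ((X - C (μ - ν)) ^ (N + N)) (X : ℂ[X]) := by
    have := isCoprime_X_sub_C_of_isUnit_sub (R := ℂ) (a := μ - ν) (b := 0)
      (by simpa using (sub_ne_zero.2 hne))
    simpa using this.pow_left (m := N + N)
  set D := aeval T q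
  have hDx : D (T x) = x := by
    have h1 := LinearMap.congr_fun (congrArg (aeval T) hsq) x
    rw [map_add (aeval T), map_mul (aeval T), map_mul (aeval T), map_pow, map_sub,
      aeval_X, aeval_C, map_one, LinearMap.add_apply, Module.End.mul_apply, Module.End.mul_apply,
      hnil, map_zero, zero_add] at h1
    exact h1
  have hcomm : Commute D T := by
    have := (Commute.all q X).map (aeval T)
    rwa [aeval_X] at this
  have hDn (n : ℕ) : (D ^ n) ((T ^ n) x) = x := by
    induction n with
    | zero => simp
    | succ n ih =>
      rw [← Module.End.mul_apply, ← hcomm.mul_pow, pow_succ, hcomm.mul_pow, Module.End.mul_apply,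
        Module.End.mul_apply D, hDx, Module.End.mul_apply, ih]
  obtain ⟨K, hK, hD⟩ := exists_norm_aeval_Cop_le a b q
  have hTx (n : ℕ) : (T ^ n) x = e μ * (T ^ n) 1 * f ν := by
    rw [← Cop_pow_mul_mul (he.commute μ) (hf.commute ν), mul_one]
  have hle : ∀ᶠ n : ℕ in atTop, ‖x‖ ≤ ‖e μ‖ * ‖f ν‖ * (1 / 2 : ℝ) ^ n := by
    filter_upwards [eventually_norm_Cop_pow_lt h (show 0 < 1 / (2 * (K + 1)) by positivity)]
      with n hn
    calc ‖x‖ = ‖(D ^ n) (e μ * (T ^ n) 1 * f ν)‖ := by rw [← hTx, hDn]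
      _ ≤ K ^ n * (‖e μ‖ * ‖(T ^ n) 1‖ * ‖f ν‖) := by
        refine (norm_pow_apply_le hK hD n _).trans ?_
        gcongr
        refine (norm_mul_le _ _).trans ?_
        gcongr
        exact norm_mul_le _ _
      _ ≤ (K + 1) ^ n * (‖e μ‖ * (1 / (2 * (K + 1))) ^ n * ‖f ν‖) := by
        gcongr
        linarith
      _ = ‖e μ‖ * ‖f ν‖ * ((K + 1) * (1 / (2 * (K + 1)))) ^ n := by rw [mul_pow]; ring
      _ = ‖e μ‖ * ‖f ν‖ * (1 / 2 : ℝ) ^ n := by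
        congr 2
        field_simp
  have hlim : Tendsto (fun n : ℕ ↦ ‖e μ‖ * ‖f ν‖ * (1 / 2 : ℝ) ^ n) atTop (nhds 0) := by
    simpa using (tendsto_pow_atTop_nhds_zero_of_lt_one (r := (1 / 2 : ℝ)) (by norm_num)
      (by norm_num)).const_mul (‖e μ‖ * ‖f ν‖)
  exact norm_le_zero_iff.1 (ge_of_tendsto hlim hle)

/-- Spectral resolutions of `a` and `b` over the same set coincide when `ρ(a,b) = 0`. -/
theorem SpectralResolution.eq_of_rho_eq_zero [NormedRing A] [NormedAlgebra ℂ A] {a b : A}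
    {S : Finset ℂ} {N : ℕ} {e f : ℂ → A} (he : SpectralResolution a S N e)
    (hf : SpectralResolution b S N f) (h : rho a b = 0) {μ : ℂ} (hμ : μ ∈ S) : e μ = f μ := by
  calc e μ = e μ * ∑ ν ∈ S, f ν := by rw [hf.sum_eq_one, mul_one]
    _ = e μ * f μ := by
      rw [Finset.mul_sum, Finset.sum_eq_single_of_mem μ hμ fun ν hν hne ↦
        he.mul_eq_zero hf h hμ hν hne.symm]
    _ = (∑ ν ∈ S, e ν) * f μ := by
      rw [Finset.sum_mul, Finset.sum_eq_single_of_mem μ hμ fun ν hν hne ↦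
        he.mul_eq_zero hf h hν hμ hne]
    _ = f μ := by rw [he.sum_eq_one, one_mul]

theorem stmt11 [NormedRing A] [NormedAlgebra ℂ A] [CompleteSpace A]
    (hA : IsSemisimpleBA A) (a b : A) (ha : a ∈ socle A) (hb : b ∈ socle A)
    (h : rho a b = 0) : ∀ lam : ℂ, sDet a lam = sDet b lam := by
  obtain ⟨p, hp, hpa⟩ := exists_aeval_eq_zero_of_mem_socle ha
  obtain ⟨q, hq, hqb⟩ := exists_aeval_eq_zero_of_mem_socle hb
  obtain ⟨S, N, e, f, he, hf⟩ := exists_spectralResolution (mul_ne_zero hp hq)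
    (by rw [map_mul, hpa, zero_mul] : Polynomial.aeval a (p * q) = 0)
    (by rw [map_mul, hqb, mul_zero] : Polynomial.aeval b (p * q) = 0)
  have hspec : spectrum ℂ a = spectrum ℂ b := by
    ext μ
    rw [he.mem_spectrum_iff, hf.mem_spectrum_iff]
    exact and_congr_right fun hμ ↦ by rw [he.eq_of_rho_eq_zero hf h hμ]
  have hriesz (μ : ℂ) (hμ : μ ∈ spectrum ℂ b) : rieszIdem a μ = rieszIdem b μ := by
    by_cases hr : ∃ r : ℝ, 0 < r ∧ spectrum ℂ b ∩ closedBall μ r = {μ}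
    · have hr' : ∃ r : ℝ, 0 < r ∧ spectrum ℂ a ∩ closedBall μ r = {μ} := by rwa [hspec]
      rw [rieszIdem, rieszIdem, dif_pos hr, dif_pos hr',
        he.rieszP_eq hr'.choose_spec.1 hr'.choose_spec.2,
        hf.rieszP_eq hr.choose_spec.1 hr.choose_spec.2,
        he.eq_of_rho_eq_zero hf h (hf.mem_spectrum_iff.1 hμ).1]
    · rw [rieszIdem, rieszIdem, dif_neg hr, dif_neg (by rwa [hspec])]
  intro lam
  unfold sDet sMult
  rw [hspec]
  exact finprod_mem_congr rfl fun μ hμ ↦ by rw [hriesz μ hμ.1]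
end

section
/- Let A be a semisimple unital complex Banach algebra and a, b ∈ Soc(A). Then a = b if and only if ρ(xa, xb) = 0 for all x in some nonempty open subset N of Soc(A). -/
open Filter Metric

variable {A : Type*}

section SimpleModule

variable {X : Type*} [NormedRing A] [NormedAlgebra ℂ A] [CompleteSpace A]
  [NormedAddCommGroup X] [NormedSpace ℂ X] [CompleteSpace X] [Module A X]
  [IsScalarTower ℂ A X] [IsBoundedSMul A X] [IsSimpleModule A X]

/-- Module endomorphisms of a simple Banach module are continuous. -/
theorem continuous_of_isSimpleModule (T : X →ₗ[A] X) : Continuous T := by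
  have := IsSimpleModule.nontrivial A X
  obtain ⟨ξ, hξ⟩ := exists_ne (0 : X)
  let g : X → A →L[ℂ] X := fun η =>
    ⟨(LinearMap.toSpanSingleton A X η).restrictScalars ℂ, continuous_id.smul continuous_const⟩
  have hg : Function.Surjective (g ξ) := IsSimpleModule.toSpanSingleton_surjective A hξ
  rw [((g ξ).isQuotientMap hg).continuous_iff]
  convert (g (T ξ)).continuous using 1
  ext r
  exact T.map_smul r ξ

/-- Schur's lemma for simple Banach modules. -/
theorem exists_eq_smul_of_isSimpleModule (T : X →ₗ[A] X) : ∃ c : ℂ, ∀ ζ, T ζ = c • ζ := by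
  have := IsSimpleModule.nontrivial A X
  let S : X →L[ℂ] X := ⟨T.restrictScalars ℂ, continuous_of_isSimpleModule T⟩
  obtain ⟨c, hc⟩ := spectrum.nonempty S
  refine ⟨c, ?_⟩
  have hT : ∀ ζ, (algebraMap ℂ (X →L[ℂ] X) c - S) ζ = (c • LinearMap.id - T : X →ₗ[A] X) ζ :=
    fun ζ => by
      simp only [Algebra.algebraMap_eq_smul_one]
      rfl
  rcases LinearMap.bijective_or_eq_zero (c • LinearMap.id - T : X →ₗ[A] X) with h | h
  · refine absurd ?_ hc
    change IsUnit _
    rw [ContinuousLinearMap.isUnit_iff_bijective]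
    convert h using 1
    exact funext hT
  · intro ζ
    have : c • ζ - T ζ = 0 := LinearMap.congr_fun h ζ
    exact (sub_eq_zero.mp this).symm

/-- An element of a minimal left ideal acts on a simple module with rank at most one. -/
theorem smul_mem_span_of_mem_atom {I : Ideal A} (hI : IsAtom I) {m : A} (hm : m ∈ I) {η : X}
    (hη : m • η ≠ 0) (ζ : X) : m • ζ ∈ Submodule.span ℂ {m • η} := by
  have : IsSimpleModule A I := isSimpleModule_iff_isAtom.mpr hI
  let f : X → I →ₗ[A] X := fun θ => (LinearMap.toSpanSingleton A X θ).domRestrict I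
  have hf : f η ≠ 0 := fun h => hη (LinearMap.congr_fun h ⟨m, hm⟩)
  let e := LinearEquiv.ofBijective (f η) ((LinearMap.bijective_or_eq_zero _).resolve_right hf)
  obtain ⟨c, hc⟩ := exists_eq_smul_of_isSimpleModule (f ζ ∘ₗ e.symm.toLinearMap)
  refine Submodule.mem_span_singleton.mpr ⟨c, ?_⟩
  have := hc (e ⟨m, hm⟩)
  simp only [LinearMap.comp_apply, LinearEquiv.coe_coe, LinearEquiv.symm_apply_apply] at this
  exact this.symm

/-- Elements of the socle act on simple modules with finite rank. -/
theorem finiteDimensional_range_of_mem_socle {r : A} (hr : r ∈ socle A) :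
    FiniteDimensional ℂ (LinearMap.range (Algebra.lsmul ℂ ℂ X r)) := by
  rw [socle, sSup_eq_iSup'] at hr
  induction hr using Submodule.iSup_induction' with
  | mem I m hm =>
    by_cases h : ∃ η : X, m • η ≠ 0
    · obtain ⟨η, hη⟩ := h
      refine Submodule.finiteDimensional_of_le (S₂ := Submodule.span ℂ {m • η}) ?_
      rintro _ ⟨ζ, rfl⟩
      exact smul_mem_span_of_mem_atom I.2 hm hη ζ
    · push Not at h
      have : Algebra.lsmul ℂ ℂ X m = 0 := LinearMap.ext h
      rw [this, LinearMap.range_zero]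
      infer_instance
  | zero =>
    rw [map_zero, LinearMap.range_zero]
    infer_instance
  | add x y _ _ hx hy =>
    rw [map_add]
    exact Submodule.finiteDimensional_of_le (LinearMap.range_add_le _ _)

end SimpleModule

/-- The socle is a right ideal. -/
theorem mul_mem_socle [Ring A] {r : A} (hr : r ∈ socle A) (s : A) : r * s ∈ socle A := by
  suffices h : socle A ≤ Submodule.comap (LinearMap.toSpanSingleton A A s) (socle A) from h hr
  refine sSup_le fun I hI => ?_
  have : IsSimpleModule A I := isSimpleModule_iff_isAtom.mpr hI
  intro i hi
  let f : I →ₗ[A] A := (LinearMap.toSpanSingleton A A s).domRestrict I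
  rcases LinearMap.injective_or_eq_zero f with h | h
  · have := IsSimpleModule.congr (LinearEquiv.ofInjective f h).symm
    have hf : LinearMap.range f ≤ socle A := le_sSup (isSimpleModule_iff_isAtom.mp this)
    exact hf ⟨⟨i, hi⟩, rfl⟩
  · have : i • s = 0 := LinearMap.congr_fun h ⟨i, hi⟩
    rw [Submodule.mem_comap, LinearMap.toSpanSingleton_apply, this]
    exact zero_mem _

/-- A socle element acting nontrivially on a simple Banach module admits a left multiple, by an
element of the socle of rank one, that fixes a given vector outside the kernel. -/
theorem exists_mem_socle_mul_smul_eq {X : Type*} [NormedRing A] [NormedAlgebra ℂ A]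
    [CompleteSpace A] [NormedAddCommGroup X] [NormedSpace ℂ X] [CompleteSpace X] [Module A X]
    [IsScalarTower ℂ A X] [IsBoundedSMul A X] [IsSimpleModule A X]
    {c : A} (hc : c ∈ socle A) {ξ : X} (hξ : c • ξ ≠ 0) :
    ∃ y ∈ socle A, (y * c) • ξ = ξ ∧ ∀ ζ : X, y • ζ ∈ Submodule.span ℂ {ξ} := by
  obtain ⟨I, hI, i, hi, ζ, hζ⟩ : ∃ I : Ideal A, IsAtom I ∧ ∃ i ∈ I, ∃ ζ : X, i • ζ ≠ 0 := by
    by_contra! h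
    have : socle A ≤ Module.annihilator A X :=
      sSup_le fun I hI i hi => Module.mem_annihilator.mpr (h I hI i hi)
    exact hξ (Module.mem_annihilator.mp (this hc) ξ)
  obtain ⟨w, rfl⟩ : ∃ w : A, w • c • ξ = ζ := IsSimpleModule.toSpanSingleton_surjective A hξ ζ
  obtain ⟨s, hs⟩ : ∃ s : A, s • i • w • c • ξ = ξ :=
    IsSimpleModule.toSpanSingleton_surjective A hζ ξ
  refine ⟨s * (i * w), (socle A).mul_mem_left s (mul_mem_socle (le_sSup (a := I) hI hi) w), ?_, ?_⟩
  · simpa only [mul_smul] using hs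
  · intro η
    obtain ⟨t, ht⟩ := Submodule.mem_span_singleton.mp (smul_mem_span_of_mem_atom hI hi hζ (w • η))
    refine Submodule.mem_span_singleton.mpr ⟨t, ?_⟩
    rw [mul_smul, mul_smul, ← ht, smul_comm s t, hs]

theorem norm_Cop_pow_one_le [NormedRing A] [NormedAlgebra ℂ A] (u v : A) (n : ℕ) :
    ‖(Cop u v ^ n) 1‖ ≤ (‖u‖ + ‖v‖) ^ n * ‖(1 : A)‖ := by
  induction n with
  | zero => simp
  | succ n ih =>
    rw [pow_succ', Module.End.mul_apply]
    set T := (Cop u v ^ n) 1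
    calc ‖Cop u v T‖ = ‖u * T - T * v‖ := by simp [Cop]
      _ ≤ ‖u * T‖ + ‖T * v‖ := norm_sub_le _ _
      _ ≤ ‖u‖ * ‖T‖ + ‖T‖ * ‖v‖ := by gcongr <;> exact norm_mul_le _ _
      _ = (‖u‖ + ‖v‖) * ‖T‖ := by ring
      _ ≤ (‖u‖ + ‖v‖) * ((‖u‖ + ‖v‖) ^ n * ‖(1 : A)‖) := by gcongr
      _ = (‖u‖ + ‖v‖) ^ (n + 1) * ‖(1 : A)‖ := by ring

/-- If `ρ(u,v) = 0`, the iterates `C_{u,v}^n 1` decay faster than any geometric sequence. -/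
theorem eventually_norm_Cop_pow_one_le [NormedRing A] [NormedAlgebra ℂ A] {u v : A}
    (h : rho u v = 0) {ε : ℝ} (hε : 0 < ε) : ∀ᶠ n : ℕ in atTop, ‖(Cop u v ^ n) 1‖ ≤ ε ^ n := by
  have hbdd : IsBoundedUnder (· ≤ ·) atTop
      (fun n : ℕ => ‖(Cop u v ^ n) 1‖ ^ (1 / (n : ℝ))) := by
    refine isBoundedUnder_of_eventually_le (a := (‖u‖ + ‖v‖) * max 1 ‖(1 : A)‖) ?_
    filter_upwards [eventually_ge_atTop 1] with n hn
    have hn' : n ≠ 0 := by omega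
    rw [one_div, Real.rpow_inv_le_iff_of_pos (norm_nonneg _) (by positivity) (by positivity),
      Real.rpow_natCast, mul_pow]
    refine (norm_Cop_pow_one_le u v n).trans ?_
    gcongr
    exact (le_max_right _ _).trans (le_self_pow₀ (le_max_left _ _) hn')
  have hlt : limsup (fun n : ℕ => ‖(Cop u v ^ n) 1‖ ^ (1 / (n : ℝ))) atTop < ε := by
    rw [← rho, h]; exact hε
  filter_upwards [eventually_lt_of_limsup_lt hlt hbdd, eventually_ge_atTop 1] with n hn hn1
  rw [one_div] at hn
  have := (Real.rpow_inv_le_iff_of_pos (norm_nonneg _) hε.le (by positivity)).mp hn.le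
  rwa [Real.rpow_natCast] at this

theorem rho_self [NormedRing A] [NormedAlgebra ℂ A] (u : A) : rho u u = 0 := by
  refine Tendsto.limsup_eq (tendsto_const_nhds.congr' ?_)
  filter_upwards [eventually_ge_atTop 1] with n hn
  obtain ⟨k, rfl⟩ := Nat.exists_eq_add_of_le' hn
  have h1 : Cop u u 1 = 0 := by simp [Cop]
  rw [pow_succ, Module.End.mul_apply, h1, map_zero, norm_zero, Real.zero_rpow (by positivity)]

/-- On a finite-dimensional space, a vector whose orbit decays faster than any geometric sequence
is eventually killed. -/
theorem exists_pow_apply_eq_zero_of_decay {V : Type*} [NormedAddCommGroup V] [NormedSpace ℂ V]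
    [FiniteDimensional ℂ V] (D : Module.End ℂ V) (η : V)
    (h : ∀ ε : ℝ, 0 < ε → ∀ᶠ n : ℕ in atTop, ‖(D ^ n) η‖ ≤ ε ^ n) : ∃ m, (D ^ m) η = 0 := by
  obtain ⟨m, hm, hm1⟩ :=
    ((D.eventually_isCompl_ker_pow_range_pow).and (eventually_ge_atTop 1)).exists
  refine ⟨m, ?_⟩
  let R := LinearMap.range (D ^ m)
  have hinj : Function.Injective (D ∘ₗ R.subtype) := by
    rw [← LinearMap.ker_eq_bot, LinearMap.ker_eq_bot']
    rintro ⟨x, hx⟩ hx0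
    replace hx0 : D x = 0 := hx0
    have : x ∈ LinearMap.ker (D ^ m) := by
      obtain ⟨k, rfl⟩ := Nat.exists_eq_add_of_le' hm1
      rw [LinearMap.mem_ker, pow_succ, Module.End.mul_apply, hx0, map_zero]
    simpa using hm.disjoint.le_bot (Submodule.mem_inf.mpr ⟨this, hx⟩)
  obtain ⟨K, hK, hanti⟩ := (D ∘ₗ R.subtype).injective_iff_antilipschitz.mp hinj
  have hstep : ∀ x ∈ R, ‖x‖ ≤ K * ‖D x‖ := fun x hx => by
    simpa using hanti.le_mul_dist ⟨x, hx⟩ 0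
  have hmem : ∀ n, (D ^ (n + m)) η ∈ R := fun n => by
    rw [add_comm, pow_add]; exact ⟨_, rfl⟩
  have hiter : ∀ n, ‖(D ^ m) η‖ ≤ (K : ℝ) ^ n * ‖(D ^ (n + m)) η‖ := by
    intro n
    induction n with
    | zero => simp
    | succ n ih =>
      have := hstep _ (hmem n)
      rw [← Module.End.mul_apply, ← pow_succ'] at this
      calc _ ≤ (K : ℝ) ^ n * ‖(D ^ (n + m)) η‖ := ih
        _ ≤ (K : ℝ) ^ n * (K * ‖(D ^ (n + m + 1)) η‖) := by gcongr
        _ = _ := by rw [add_right_comm]; ring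
  have hK' : (0 : ℝ) < K := hK
  have hε : (0 : ℝ) < (2 * K : ℝ)⁻¹ := by positivity
  have hlim : Tendsto (fun n : ℕ => ((2 * K : ℝ)⁻¹) ^ m * (2⁻¹ : ℝ) ^ n) atTop (nhds 0) := by
    simpa using (tendsto_pow_atTop_nhds_zero_of_lt_one (r := (2⁻¹ : ℝ))
      (by norm_num) (by norm_num)).const_mul (((2 * K : ℝ)⁻¹) ^ m)
  refine norm_le_zero_iff.mp (ge_of_tendsto hlim ?_)
  filter_upwards [(tendsto_add_atTop_nat m).eventually (h _ hε)] with n hn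
  calc _ ≤ (K : ℝ) ^ n * ‖(D ^ (n + m)) η‖ := hiter n
    _ ≤ (K : ℝ) ^ n * ((2 * K : ℝ)⁻¹) ^ (n + m) := by gcongr
    _ = _ := by
      rw [pow_add, mul_inv, mul_pow _ _ n]
      field_simp
      simp [hK'.ne']

theorem sub_pow_apply_eq_zero_of_pow_apply_eq_zero {F : Type*} [AddCommGroup F] [Module ℂ F]
    (u v : Module.End ℂ F) (c : ℂ) (i k : ℕ) (T : Module.End ℂ F) (ζ : F)
    (hT : ((LinearMap.mulLeft ℂ u - LinearMap.mulRight ℂ v) ^ i) T = 0)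
    (hζ : ((v - algebraMap ℂ _ c) ^ k) ζ = 0) :
    ((u - algebraMap ℂ _ c) ^ (i + k)) (T ζ) = 0 := by
  induction h : i + k generalizing i k T ζ with
  | zero =>
    obtain ⟨rfl, rfl⟩ := Nat.add_eq_zero_iff.mp h
    have : T = 0 := hT
    simp [this]
  | succ n ih =>
    have hsplit : (u - algebraMap ℂ _ c) (T ζ) =
        ((LinearMap.mulLeft ℂ u - LinearMap.mulRight ℂ v) T) ζ +
          T ((v - algebraMap ℂ _ c) ζ) := by
      simp [Algebra.algebraMap_eq_smul_one]
    rw [pow_succ, Module.End.mul_apply, hsplit, map_add]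
    rcases i with _ | i
    · have : T = 0 := hT
      simp [this]
    rcases k with _ | k
    · have : ζ = 0 := hζ
      simp [this]
    rw [ih i (k + 1) _ ζ (by rwa [pow_succ, Module.End.mul_apply] at hT) hζ (by omega),
      ih (i + 1) k T _ hT (by rwa [pow_succ, Module.End.mul_apply] at hζ) (by omega), add_zero]

/-- If `C_{u,v}` is nilpotent at `1`, then `u` and `v` have the same trace. -/
theorem trace_eq_of_pow_apply_one_eq_zero {F : Type*} [AddCommGroup F] [Module ℂ F]
    [FiniteDimensional ℂ F] (u v : Module.End ℂ F) (m : ℕ)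
    (h : ((LinearMap.mulLeft ℂ u - LinearMap.mulRight ℂ v) ^ m) (1 : Module.End ℂ F) = 0) :
    LinearMap.trace ℂ F u = LinearMap.trace ℂ F v := by
  have hle : ∀ c, v.maxGenEigenspace c ≤ u.maxGenEigenspace c := by
    intro c ζ hζ
    rw [Module.End.mem_maxGenEigenspace] at hζ ⊢
    obtain ⟨k, hk⟩ := hζ
    exact ⟨m + k, sub_pow_apply_eq_zero_of_pow_apply_eq_zero u v c m k 1 ζ h hk⟩
  have heq : ∀ c, v.maxGenEigenspace c = u.maxGenEigenspace c := by
    intro c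
    refine le_antisymm (hle c) ?_
    have hdisj : Disjoint (⨆ (d) (_ : d ≠ c), v.maxGenEigenspace d) (u.maxGenEigenspace c) :=
      (u.independent_maxGenEigenspace c).symm.mono_left (iSup₂_mono fun d _ => hle d)
    have htop : v.maxGenEigenspace c ⊔ ⨆ (d) (_ : d ≠ c), v.maxGenEigenspace d = ⊤ := by
      rw [← iSup_split_single, Module.End.iSup_maxGenEigenspace_eq_top]
    calc u.maxGenEigenspace c = (v.maxGenEigenspace c ⊔ ⨆ (d) (_ : d ≠ c), v.maxGenEigenspace d) ⊓
            u.maxGenEigenspace c := by rw [htop, top_inf_eq]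
      _ = v.maxGenEigenspace c := by
        rw [sup_inf_assoc_of_le _ (hle c), hdisj.eq_bot, sup_bot_eq]
      _ ≤ _ := le_rfl
  have hint : DirectSum.IsInternal v.maxGenEigenspace :=
    (DirectSum.isInternal_submodule_iff_iSupIndep_and_iSup_eq_top _).mpr
      ⟨v.independent_maxGenEigenspace, v.iSup_maxGenEigenspace_eq_top⟩
  have hfin : {c | v.maxGenEigenspace c ≠ ⊥}.Finite :=
    WellFoundedGT.finite_ne_bot_of_iSupIndep v.independent_maxGenEigenspace
  have hmaps : ∀ w : Module.End ℂ F, ∀ c,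
      Set.MapsTo w (w.maxGenEigenspace c) (w.maxGenEigenspace c) :=
    fun w c => w.mapsTo_maxGenEigenspace_of_comm (Commute.refl _) c
  have htrace : ∀ (w : Module.End ℂ F) (c : ℂ),
      LinearMap.trace ℂ _ (w.restrict (hmaps w c)) =
        c * Module.finrank ℂ (w.maxGenEigenspace c) := by
    intro w c
    have := (LinearMap.isNilpotent_trace_of_isNilpotent
      (w.isNilpotent_restrict_maxGenEigenspace_sub_algebraMap c)).eq_zero
    have h2 : (w - algebraMap ℂ _ c).restrict
        (w.mapsTo_maxGenEigenspace_of_comm (Algebra.mul_sub_algebraMap_commutes w c) c) =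
        w.restrict (hmaps w c) - c • LinearMap.id := by
      ext; rfl
    rw [h2, map_sub, map_smul, LinearMap.trace_id, sub_eq_zero] at this
    simpa using this
  have hmaps' : ∀ c, Set.MapsTo u (v.maxGenEigenspace c) (v.maxGenEigenspace c) :=
    fun c => by rw [heq c]; exact hmaps u c
  rw [LinearMap.trace_eq_sum_trace_restrict' hint hfin (hmaps v),
    LinearMap.trace_eq_sum_trace_restrict' hint hfin hmaps']
  refine Finset.sum_congr rfl fun c _ => ?_
  have : ∀ (E : Submodule ℂ F) (hE : E = u.maxGenEigenspace c) (hu : Set.MapsTo u E E),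
      LinearMap.trace ℂ E (u.restrict hu) = c * Module.finrank ℂ E := by
    rintro E rfl hu
    exact htrace u c
  rw [htrace v c, this _ (heq c)]

/-- If `ρ(u,v) = 0`, then `u` and `v` have the same trace on every finite-dimensional subspace of
a normed module that is invariant under both. -/
theorem trace_restrict_eq_of_rho_eq_zero {X : Type*} [NormedRing A] [NormedAlgebra ℂ A]
    [NormedAddCommGroup X] [NormedSpace ℂ X] [Module A X] [IsScalarTower ℂ A X]
    [IsBoundedSMul A X] (F : Submodule ℂ X) [FiniteDimensional ℂ F] {u v : A}
    (hu : ∀ ζ ∈ F, Algebra.lsmul ℂ ℂ X u ζ ∈ F) (hv : ∀ ζ ∈ F, Algebra.lsmul ℂ ℂ X v ζ ∈ F)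
    (h : rho u v = 0) :
    LinearMap.trace ℂ F ((Algebra.lsmul ℂ ℂ X u).restrict hu) =
      LinearMap.trace ℂ F ((Algebra.lsmul ℂ ℂ X v).restrict hv) := by
  set u' := (Algebra.lsmul ℂ ℂ X u).restrict hu
  set v' := (Algebra.lsmul ℂ ℂ X v).restrict hv
  let D : Module.End ℂ (F →L[ℂ] F) :=
    Cop (LinearMap.toContinuousLinearMap u') (LinearMap.toContinuousLinearMap v')
  have hD : ∀ (n : ℕ) (ζ : F), ((((D ^ n) 1) ζ : F) : X) = ((Cop u v ^ n) 1) • (ζ : X) := by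
    intro n
    induction n with
    | zero => intro ζ; simp
    | succ n ih =>
      intro ζ
      rw [pow_succ', pow_succ', Module.End.mul_apply, Module.End.mul_apply]
      have hl : (((D ((D ^ n) 1)) ζ : F) : X) =
          u • (((D ^ n) 1 ζ : F) : X) - (((D ^ n) 1 (v' ζ) : F) : X) := rfl
      have hr : Cop u v ((Cop u v ^ n) 1) = u * (Cop u v ^ n) 1 - (Cop u v ^ n) 1 * v := rfl
      rw [hl, hr, ih, ih, sub_smul, mul_smul, mul_smul]
      rfl
  have hnorm : ∀ n : ℕ, ‖(D ^ n) 1‖ ≤ ‖(Cop u v ^ n) 1‖ := fun n =>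
    ContinuousLinearMap.opNorm_le_bound _ (norm_nonneg _) fun ζ => by
      change ‖(((D ^ n) 1 ζ : F) : X)‖ ≤ _
      rw [hD]
      exact norm_smul_le _ (ζ : X)
  have : FiniteDimensional ℂ (F →L[ℂ] F) :=
    LinearMap.toContinuousLinearMap.finiteDimensional
  obtain ⟨m, hm⟩ := exists_pow_apply_eq_zero_of_decay D (1 : F →L[ℂ] F) fun ε hε =>
    (eventually_norm_Cop_pow_one_le h hε).mono fun n hn => (hnorm n).trans hn
  have hcoe : ∀ n : ℕ, ((LinearMap.mulLeft ℂ u' - LinearMap.mulRight ℂ v') ^ n)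
      (1 : Module.End ℂ F) = ((D ^ n) 1 : F →L[ℂ] F) := by
    intro n
    induction n with
    | zero => rfl
    | succ n ih =>
      rw [pow_succ', pow_succ', Module.End.mul_apply, Module.End.mul_apply, ih]
      rfl
  exact trace_eq_of_pow_apply_one_eq_zero u' v' m (by rw [hcoe, hm]; rfl)

instance isBoundedSMul_quotient [NormedRing A] (M : Ideal A) : IsBoundedSMul A (A ⧸ M) :=
  .of_norm_smul_le fun r x => by
    refine le_of_forall_pos_le_add fun ε hε => ?_
    have hδ : 0 < ε / (‖r‖ + 1) := by positivity
    obtain ⟨y, rfl, hy⟩ := Submodule.Quotient.norm_mk_lt x hδ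
    calc ‖r • Submodule.Quotient.mk (p := M) y‖ ≤ ‖r * y‖ :=
          Submodule.Quotient.norm_mk_le M (r * y)
      _ ≤ ‖r‖ * ‖y‖ := norm_mul_le _ _
      _ ≤ ‖r‖ * (‖Submodule.Quotient.mk (p := M) y‖ + ε / (‖r‖ + 1)) := by gcongr
      _ ≤ ‖r‖ * ‖Submodule.Quotient.mk (p := M) y‖ + ε := by
        rw [mul_add]
        gcongr
        rw [mul_div_assoc', div_le_iff₀ (by positivity)]
        nlinarith

/-- If `ρ(xa, xb) = 0` for all `x` in a nonempty relatively open subset of the socle, then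
`a - b` annihilates every simple Banach module. -/
theorem sub_smul_eq_zero_of_rho_eq_zero {X : Type*} [NormedRing A] [NormedAlgebra ℂ A]
    [CompleteSpace A] [NormedAddCommGroup X] [NormedSpace ℂ X] [CompleteSpace X] [Module A X]
    [IsScalarTower ℂ A X] [IsBoundedSMul A X] [IsSimpleModule A X]
    {a b : A} (ha : a ∈ socle A) (hb : b ∈ socle A) {U : Set A} (hU : IsOpen U)
    {x : A} (hxU : x ∈ U) (hx : x ∈ socle A)
    (h : ∀ z ∈ U, z ∈ socle A → rho (z * a) (z * b) = 0) (ξ : X) : (a - b) • ξ = 0 := by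
  by_contra hξ
  obtain ⟨y, hy, hfix, hspan⟩ := exists_mem_socle_mul_smul_eq (sub_mem ha hb) hξ
  obtain ⟨t, ht0, htU⟩ : ∃ t : ℂ, t ≠ 0 ∧ x + t • y ∈ U := by
    have hc : Continuous fun t : ℂ => x + t • y := by fun_prop
    have h0 : ∀ᶠ t in nhdsWithin (0 : ℂ) {0}ᶜ, x + t • y ∈ U :=
      (hc.tendsto' 0 x (by simp)).mono_left nhdsWithin_le_nhds |>.eventually (hU.mem_nhds hxU)
    obtain ⟨t, ht, ht0⟩ := (h0.and self_mem_nhdsWithin).exists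
    exact ⟨t, ht0, ht⟩
  let π := Algebra.lsmul (A := A) ℂ ℂ X
  have hfa := finiteDimensional_range_of_mem_socle (X := X) ((socle A).mul_mem_left x ha)
  have hfb := finiteDimensional_range_of_mem_socle (X := X) ((socle A).mul_mem_left x hb)
  let F : Submodule ℂ X := LinearMap.range (π (x * a)) ⊔ LinearMap.range (π (x * b)) ⊔
    Submodule.span ℂ {ξ}
  have hspanF : Submodule.span ℂ {ξ} ≤ F := le_sup_right
  have hyF : ∀ r : A, ∀ ζ ∈ F, π (y * r) ζ ∈ F := fun r ζ _ => hspanF <| by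
    rw [show π (y * r) ζ = y • r • ζ from mul_smul y r ζ]
    exact hspan _
  have hxa : ∀ ζ ∈ F, π (x * a) ζ ∈ F := fun ζ _ => le_sup_left (b := Submodule.span ℂ {ξ})
    (Submodule.mem_sup_left ⟨ζ, rfl⟩)
  have hxb : ∀ ζ ∈ F, π (x * b) ζ ∈ F := fun ζ _ => le_sup_left (b := Submodule.span ℂ {ξ})
    (Submodule.mem_sup_right ⟨ζ, rfl⟩)
  have hπ : ∀ r : A, π ((x + t • y) * r) = π (x * r) + t • π (y * r) := fun r => by
    rw [add_mul, smul_mul_assoc, map_add, map_smul]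
  have hta : ∀ ζ ∈ F, π ((x + t • y) * a) ζ ∈ F := fun ζ hζ => by
    rw [hπ]; exact F.add_mem (hxa ζ hζ) (F.smul_mem t (hyF a ζ hζ))
  have htb : ∀ ζ ∈ F, π ((x + t • y) * b) ζ ∈ F := fun ζ hζ => by
    rw [hπ]; exact F.add_mem (hxb ζ hζ) (F.smul_mem t (hyF b ζ hζ))
  have h0 := trace_restrict_eq_of_rho_eq_zero F hxa hxb (h x hxU hx)
  have h1 := trace_restrict_eq_of_rho_eq_zero F hta htb
    (h _ htU ((socle A).add_mem hx (Submodule.smul_of_tower_mem _ t hy)))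
  have hra : (π ((x + t • y) * a)).restrict hta =
      (π (x * a)).restrict hxa + t • (π (y * a)).restrict (hyF a) := by
    ext ζ; exact LinearMap.congr_fun (hπ a) (ζ : X)
  have hrb : (π ((x + t • y) * b)).restrict htb =
      (π (x * b)).restrict hxb + t • (π (y * b)).restrict (hyF b) := by
    ext ζ; exact LinearMap.congr_fun (hπ b) (ζ : X)
  change LinearMap.trace ℂ F ((π ((x + t • y) * a)).restrict hta) =
    LinearMap.trace ℂ F ((π ((x + t • y) * b)).restrict htb) at h1
  rw [hra, hrb, map_add, map_add, map_smul, map_smul, h0, add_right_inj] at h1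
  have heq := smul_right_injective ℂ ht0 h1
  have hsub : (π (y * (a - b))).restrict (hyF (a - b)) =
      (π (y * a)).restrict (hyF a) - (π (y * b)).restrict (hyF b) := by
    ext ζ
    have : π (y * (a - b)) = π (y * a) - π (y * b) := by rw [mul_sub, map_sub]
    exact LinearMap.congr_fun this (ζ : X)
  have hzero : LinearMap.trace ℂ F ((π (y * (a - b))).restrict (hyF (a - b))) = 0 := by
    rw [hsub, map_sub, heq, sub_self]
  let ξ' : F := ⟨ξ, hspanF (Submodule.mem_span_singleton_self ξ)⟩
  have hproj : LinearMap.IsProj (Submodule.span ℂ {ξ'})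
      ((π (y * (a - b))).restrict (hyF (a - b))) := by
    refine ⟨fun ζ => ?_, fun ζ hζ => ?_⟩
    · obtain ⟨s, hs⟩ := Submodule.mem_span_singleton.mp (hspan ((a - b) • (ζ : X)))
      refine Submodule.mem_span_singleton.mpr ⟨s, Subtype.ext ?_⟩
      exact hs.trans (mul_smul y (a - b) (ζ : X)).symm
    · obtain ⟨s, rfl⟩ := Submodule.mem_span_singleton.mp hζ
      rw [map_smul]
      exact congrArg (s • ·) (Subtype.ext hfix)
  have hξ' : ξ' ≠ 0 := fun h0 => hξ <| by
    rw [show ξ = 0 from congrArg Subtype.val h0, smul_zero]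
  rw [hproj.trace, finrank_span_singleton hξ'] at hzero
  simp at hzero

theorem stmt13 [NormedRing A] [NormedAlgebra ℂ A] [CompleteSpace A]
    (hA : IsSemisimpleBA A) (a b : A) (ha : a ∈ socle A) (hb : b ∈ socle A) :
    a = b ↔ ∃ N : Set A, N.Nonempty ∧ N ⊆ (socle A : Set A) ∧
      (∃ U : Set A, IsOpen U ∧ N = U ∩ (socle A : Set A)) ∧
      ∀ x ∈ N, rho (x * a) (x * b) = 0 := by
  constructor
  · rintro rfl
    exact ⟨socle A, ⟨0, zero_mem _⟩, subset_rfl, ⟨Set.univ, isOpen_univ, (Set.univ_inter _).symm⟩,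
      fun x _ => rho_self (x * a)⟩
  · rintro ⟨N, ⟨x, hxN⟩, -, ⟨U, hU, rfl⟩, h⟩
    rw [← sub_eq_zero, ← Submodule.mem_bot (R := A), ← hA, Ideal.jacobson, Submodule.mem_sInf]
    rintro (M : Ideal A) ⟨-, hM⟩
    have : Ideal.IsMaximal M := hM
    have : IsSimpleModule A (A ⧸ M) := isSimpleModule_iff_isCoatom.mpr hM.out
    have := sub_smul_eq_zero_of_rho_eq_zero ha hb hU hxN.1 hxN.2
      (fun z hz hz' => h z ⟨hz, hz'⟩) (Submodule.Quotient.mk (p := M) 1)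
    rwa [← Submodule.Quotient.mk_smul, smul_eq_mul, mul_one, Submodule.Quotient.mk_eq_zero] at this
end
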